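/- Subadditivity and strong subadditivity for compatible subalgebras: Let 𝔄₁, 𝔄₂, 𝔄₃ be pairwise compatible unital *-subalgebras of M_n(ℂ) and ρ a state on M_n(ℂ). Then (i) H_ρ(𝔄₁𝔄₂) ≤ H_ρ(𝔄₁) + H_ρ(𝔄₂), and (ii) H_ρ(𝔄₁𝔄₂𝔄₃) + H_ρ(𝔄₂) ≤ H_ρ(𝔄₁𝔄₂) + H_ρ(𝔄₂𝔄₃). -/

import Mathlib

open scoped ComplexOrder Kronecker
open Matrix

noncomputable def negMulLogb (x : ℝ) : ℝ := -(x * Real.logb 2 x)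

noncomputable def shannonEntropy {α : Type*} [Fintype α] (p : α → ℝ) : ℝ :=
  ∑ i, negMulLogb (p i)

noncomputable def mutualInfo {α β : Type*} [Fintype α] [Fintype β]
    (p : α → β → ℝ) : ℝ :=
  shannonEntropy (fun i => ∑ j, p i j) + shannonEntropy (fun j => ∑ i, p i j)
    - shannonEntropy (fun ij : α × β => p ij.1 ij.2)

noncomputable def binEnt (t : ℝ) : ℝ := negMulLogb t + negMulLogb (1 - t)

noncomputable def vnEntropy {α : Type*} [Fintype α] [DecidableEq α]
    (ρ : Matrix α α ℂ) : ℝ :=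
  if h : ρ.IsHermitian then ∑ i, negMulLogb (h.eigenvalues i) else 0

noncomputable def matLogb {α : Type*} [Fintype α] [DecidableEq α]
    (A : Matrix α α ℂ) : Matrix α α ℂ :=
  if h : A.IsHermitian then
    (h.eigenvectorUnitary : Matrix α α ℂ) *
      Matrix.diagonal (fun i => (Real.logb 2 (h.eigenvalues i) : ℂ)) *
      star (h.eigenvectorUnitary : Matrix α α ℂ)
  else 0

def MatState {α : Type*} [Fintype α] [DecidableEq α] (ρ : Matrix α α ℂ) : Prop :=
  ρ.PosSemidef ∧ ρ.trace = 1

def IsProjn {α : Type*} [Fintype α] [DecidableEq α] (p : Matrix α α ℂ) : Prop :=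
  p.IsHermitian ∧ p * p = p

def IsMinProjOf {α : Type*} [Fintype α] [DecidableEq α]
    (X : StarSubalgebra ℂ (Matrix α α ℂ)) (p : Matrix α α ℂ) : Prop :=
  p ∈ X ∧ IsProjn p ∧ p ≠ 0 ∧
    ∀ q ∈ X, IsProjn q → q * p = q → q = 0 ∨ q = p

def IsCanonicalTrace {α : Type*} [Fintype α] [DecidableEq α]
    (X : StarSubalgebra ℂ (Matrix α α ℂ)) (τ : Matrix α α ℂ →ₗ[ℂ] ℂ) : Prop :=
  (∀ x ∈ X, ∀ y ∈ X, τ (x * y) = τ (y * x)) ∧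
  (∀ x ∈ X, 0 ≤ τ (star x * x)) ∧
  (∀ p, IsMinProjOf X p → τ p = 1)

def IsRestriction {α : Type*} [Fintype α] [DecidableEq α]
    (X : StarSubalgebra ℂ (Matrix α α ℂ)) (τ : Matrix α α ℂ →ₗ[ℂ] ℂ)
    (ρ r : Matrix α α ℂ) : Prop :=
  r ∈ X ∧ r.PosSemidef ∧ ∀ x ∈ X, τ (r * x) = (ρ * x).trace

noncomputable def algEntropy {α : Type*} [Fintype α] [DecidableEq α]
    (τ : Matrix α α ℂ →ₗ[ℂ] ℂ) (r : Matrix α α ℂ) : ℝ :=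
  -(τ (r * matLogb r)).re

def IsAlgEntropy {α : Type*} [Fintype α] [DecidableEq α]
    (X : StarSubalgebra ℂ (Matrix α α ℂ)) (ρ : Matrix α α ℂ) (H : ℝ) : Prop :=
  ∃ τ r, IsCanonicalTrace X τ ∧ IsRestriction X τ ρ r ∧ H = algEntropy τ r

def CompatibleAlg {α : Type*} [Fintype α] [DecidableEq α]
    (X Y : StarSubalgebra ℂ (Matrix α α ℂ)) : Prop :=
  ∀ x ∈ X, ∀ y ∈ Y, x * y = y * x

variable {α : Type*} [Fintype α] [DecidableEq α]

/-- A spectral resolution of `r` inside the star subalgebra `X`. -/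
structure SpectralResolution (X : StarSubalgebra ℂ (Matrix α α ℂ)) (r : Matrix α α ℂ)
    (S : Finset ℝ) (E : ℝ → Matrix α α ℂ) : Prop where
  mem : ∀ a, E a ∈ X
  isHermitian : ∀ a, (E a).IsHermitian
  mul_self : ∀ a, E a * E a = E a
  mul_ne : ∀ a b, a ≠ b → E a * E b = 0
  sum_one : ∑ a ∈ S, E a = 1
  sum_self : ∑ a ∈ S, (a : ℂ) • E a = r
  sum_log : ∑ a ∈ S, (Real.logb 2 a : ℂ) • E a = matLogb r
  nonneg : r.PosSemidef → ∀ a ∈ S, 0 ≤ a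

theorem matLogb_eq_cfc {r : Matrix α α ℂ} (hr : r.IsHermitian) :
    matLogb r = cfc (Real.logb 2) r := by
  rw [hr.cfc_eq, Matrix.IsHermitian.cfc, Unitary.conjStarAlgAut_apply, matLogb, dif_pos hr]
  rfl

theorem exists_spectralResolution (X : StarSubalgebra ℂ (Matrix α α ℂ)) {r : Matrix α α ℂ}
    (hrX : r ∈ X) (hr : r.IsHermitian) : ∃ S E, SpectralResolution X r S E := by
  have hc : ∀ f : ℝ → ℝ, ContinuousOn f (spectrum ℝ r) := fun f =>
    (Matrix.finite_real_spectrum (A := r)).continuousOn f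
  have hsa : IsSelfAdjoint r := hr
  let S := (Matrix.finite_real_spectrum (A := r)).toFinset
  let E : ℝ → Matrix α α ℂ := fun a => cfc (fun x => if x = a then (1 : ℝ) else 0) r
  have key : ∀ f : ℝ → ℝ, ∑ a ∈ S, (f a : ℂ) • E a = cfc f r := by
    intro f
    have h1 : ∀ a ∈ S, (f a : ℂ) • E a = cfc (fun x => f a * if x = a then (1 : ℝ) else 0) r := by
      intro a _
      rw [cfc_const_mul _ _ _ (hc _)]
      rfl
    rw [Finset.sum_congr rfl h1, ← cfc_sum _ _ _ fun _ _ => hc _]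
    refine cfc_congr fun x hx => ?_
    have hxS : x ∈ S := by simpa [S] using hx
    simp [Finset.sum_apply, hxS]
  refine ⟨S, E, ?_, ?_, ?_, ?_, ?_, ?_, ?_, ?_⟩
  · intro a
    have : FiniteDimensional ℂ (Subalgebra.toSubmodule X.toSubalgebra) := inferInstance
    have hcl : IsClosed (X : Set (Matrix α α ℂ)) :=
      Submodule.closed_of_finiteDimensional (Subalgebra.toSubmodule X.toSubalgebra)
    exact cfc_mem (hs := hcl) _ hrX
  · intro a; exact cfc_predicate (p := IsSelfAdjoint) _ r
  · intro a
    simp only [E]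
    rw [← cfc_mul _ _ _ (hc _) (hc _)]
    congr 1; ext x; simp
  · intro a b hab
    simp only [E]
    rw [← cfc_mul _ _ _ (hc _) (hc _)]
    convert cfc_const_zero ℝ r with x
    aesop
  · simpa [cfc_const_one ℝ r] using key (fun _ => 1)
  · rw [key (fun x => x)]; exact cfc_id' ℝ r
  · rw [key, matLogb_eq_cfc hr]
  · intro h a ha
    simp only [S, Set.Finite.mem_toFinset] at ha
    rw [hr.spectrum_real_eq_range_eigenvalues] at ha
    obtain ⟨i, rfl⟩ := ha
    exact h.eigenvalues_nonneg i

namespace IsProjn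

variable {p q : Matrix α α ℂ}

theorem mul_eq_of_mul_eq (hp : IsProjn p) (hq : IsProjn q) (h : q * p = q) : p * q = q := by
  have := congrArg conjTranspose h
  rwa [conjTranspose_mul, hp.1.eq, hq.1.eq] at this

theorem mul_of_commute (hp : IsProjn p) (hq : IsProjn q) (h : p * q = q * p) :
    IsProjn (p * q) := by
  refine ⟨?_, ?_⟩
  · rw [IsHermitian, conjTranspose_mul, hp.1.eq, hq.1.eq, h]
  · calc p * q * (p * q) = p * (q * p) * q := by noncomm_ring
      _ = p * p * (q * q) := by rw [← h]; noncomm_ring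
      _ = p * q := by rw [hp.2, hq.2]

theorem sub (hp : IsProjn p) (hq : IsProjn q) (h : q * p = q) : IsProjn (p - q) := by
  refine ⟨hp.1.sub hq.1, ?_⟩
  have h' := hp.mul_eq_of_mul_eq hq h
  rw [sub_mul, mul_sub, mul_sub, hp.2, hq.2, h, h']
  simp

theorem range_lt (hp : IsProjn p) (hq : IsProjn q) (h : q * p = q) (hne : q ≠ p) :
    LinearMap.range q.mulVecLin < LinearMap.range p.mulVecLin := by
  have h' := hp.mul_eq_of_mul_eq hq h
  refine lt_of_le_of_ne ?_ fun heq => hne ?_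
  · rintro _ ⟨v, rfl⟩
    exact ⟨q.mulVec v, by simp [h']⟩
  · rw [← h]
    refine Matrix.toLin'.injective (LinearMap.ext fun v => ?_)
    have : p.mulVecLin v ∈ LinearMap.range q.mulVecLin := heq ▸ ⟨v, rfl⟩
    obtain ⟨u, hu⟩ := this
    simp only [mulVecLin_apply] at hu
    simp only [toLin'_apply, ← mulVec_mulVec, ← hu]
    rw [mulVec_mulVec, hq.2]

theorem posSemidef (hp : IsProjn p) : p.PosSemidef := by
  have := Matrix.posSemidef_conjTranspose_mul_self p
  rwa [hp.1.eq, hp.2] at this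

theorem mem_closure_isMinProjOf {X : StarSubalgebra ℂ (Matrix α α ℂ)} (hp : IsProjn p)
    (hpX : p ∈ X) : p ∈ AddSubmonoid.closure {q | IsMinProjOf X q} := by
  induction h : LinearMap.range p.mulVecLin using WellFoundedLT.induction generalizing p with
  | ind V ih =>
    subst h
    by_cases h0 : p = 0
    · rw [h0]; exact zero_mem _
    by_cases hm : ∀ q ∈ X, IsProjn q → q * p = q → q = 0 ∨ q = p
    · exact AddSubmonoid.subset_closure ⟨hpX, hp, h0, hm⟩
    push Not at hm
    obtain ⟨q, hqX, hq, hqp, hq0, hne⟩ := hm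
    have h1 := ih _ (hp.range_lt hq hqp hne) hq hqX rfl
    have hs := hp.sub hq hqp
    have h2 := ih _ (hp.range_lt hs (by rw [sub_mul, hp.2, hqp])
      (by simpa [sub_eq_self] using hq0)) hs (sub_mem hpX hqX) rfl
    simpa using add_mem h1 h2

end IsProjn

namespace SpectralResolution

variable {X : StarSubalgebra ℂ (Matrix α α ℂ)} {r : Matrix α α ℂ} {S : Finset ℝ}
  {E : ℝ → Matrix α α ℂ}

theorem isProjn (h : SpectralResolution X r S E) (a : ℝ) : IsProjn (E a) :=
  ⟨h.isHermitian a, h.mul_self a⟩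

theorem sum_smul_mul (h : SpectralResolution X r S E) (f : ℝ → ℂ) {a : ℝ} (ha : a ∈ S) :
    (∑ b ∈ S, f b • E b) * E a = f a • E a := by
  rw [Finset.sum_mul, Finset.sum_eq_single a]
  · rw [smul_mul_assoc, h.mul_self]
  · intro b _ hb
    rw [smul_mul_assoc, h.mul_ne _ _ hb, smul_zero]
  · exact fun h => absurd ha h

theorem mul_apply (h : SpectralResolution X r S E) {a : ℝ} (ha : a ∈ S) :
    r * E a = (a : ℂ) • E a := by
  conv_lhs => rw [← h.sum_self]
  exact h.sum_smul_mul _ ha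

theorem apply_mul (h : SpectralResolution X r S E) {a : ℝ} (ha : a ∈ S) :
    E a * r = (a : ℂ) • E a := by
  conv_lhs => rw [← h.sum_self]
  rw [Finset.mul_sum, Finset.sum_eq_single a]
  · rw [mul_smul_comm, h.mul_self]
  · intro b _ hb
    rw [mul_smul_comm, h.mul_ne _ _ hb.symm, smul_zero]
  · exact fun h => absurd ha h

theorem mono (h : SpectralResolution X r S E) {Y : StarSubalgebra ℂ (Matrix α α ℂ)}
    (hXY : X ≤ Y) : SpectralResolution Y r S E :=
  { h with mem := fun a => hXY (h.mem a) }

theorem matLogb_mem (h : SpectralResolution X r S E) : matLogb r ∈ X := by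
  rw [← h.sum_log]
  exact sum_mem fun a _ => X.smul_mem (h.mem a) _

theorem mul_matLogb (h : SpectralResolution X r S E) :
    r * matLogb r = ∑ a ∈ S, ((a * Real.logb 2 a : ℝ) : ℂ) • E a := by
  rw [← h.sum_log, Finset.mul_sum]
  refine Finset.sum_congr rfl fun a ha => ?_
  rw [mul_smul_comm, h.mul_apply ha, smul_smul, Complex.ofReal_mul, mul_comm]

end SpectralResolution

theorem re_nonneg_of_isMinProjOf {X : StarSubalgebra ℂ (Matrix α α ℂ)}
    (f : Matrix α α ℂ →ₗ[ℂ] ℂ) (hf : ∀ q, IsMinProjOf X q → 0 ≤ (f q).re)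
    {p : Matrix α α ℂ} (hp : IsProjn p) (hpX : p ∈ X) : 0 ≤ (f p).re := by
  have hmem := hp.mem_closure_isMinProjOf hpX
  clear hp hpX
  induction hmem using AddSubmonoid.closure_induction with
  | mem q hq => exact hf q hq
  | zero => simp
  | add x y _ _ hx hy => rw [map_add, Complex.add_re]; exact add_nonneg hx hy

theorem re_nonneg_of_posSemidef {X : StarSubalgebra ℂ (Matrix α α ℂ)}
    (f : Matrix α α ℂ →ₗ[ℂ] ℂ) (hf : ∀ q, IsMinProjOf X q → 0 ≤ (f q).re)
    {w : Matrix α α ℂ} (hw : w.PosSemidef) (hwX : w ∈ X) : 0 ≤ (f w).re := by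
  obtain ⟨S, E, h⟩ := exists_spectralResolution X hwX hw.1
  rw [← h.sum_self, map_sum, Complex.re_sum]
  refine Finset.sum_nonneg fun a ha => ?_
  rw [map_smul, smul_eq_mul, Complex.re_ofReal_mul]
  exact mul_nonneg (h.nonneg hw a ha) (re_nonneg_of_isMinProjOf f hf (h.isProjn a) (h.mem a))

namespace IsMinProjOf

variable {X Y : StarSubalgebra ℂ (Matrix α α ℂ)} {p q : Matrix α α ℂ}

theorem exists_smul_of_isHermitian (hq : IsMinProjOf X q) {x : Matrix α α ℂ} (hx : x ∈ X)
    (hxh : x.IsHermitian) : ∃ c : ℂ, q * x * q = c • q := by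
  obtain ⟨hqX, hqp, -, hmin⟩ := hq
  have hyX : q * x * q ∈ X := mul_mem (mul_mem hqX hx) hqX
  have hyh : (q * x * q).IsHermitian := by
    rw [IsHermitian, conjTranspose_mul, conjTranspose_mul, hqp.1.eq, hxh.eq, mul_assoc]
  obtain ⟨S, E, h⟩ := exists_spectralResolution X hyX hyh
  suffices hs : q * x * q ∈ Submodule.span ℂ {q} by
    obtain ⟨c, hc⟩ := Submodule.mem_span_singleton.1 hs
    exact ⟨c, hc.symm⟩
  rw [← h.sum_self]
  refine sum_mem fun a ha => ?_
  by_cases h0 : a = 0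
  · simp [h0]
  have h0' : (a : ℂ) ≠ 0 := by exact_mod_cast h0
  have h1 := h.apply_mul ha
  have h2 : E a * q = E a := by
    have h3 : (a : ℂ) • (E a * q) = (a : ℂ) • E a := by
      rw [← smul_mul_assoc, ← h1, ← mul_assoc, mul_assoc _ q q, hqp.2]
    exact smul_right_injective _ h0' h3
  rcases hmin _ (h.mem a) (h.isProjn a) h2 with h3 | h3
  · simp [h3]
  · rw [h3]; exact Submodule.smul_mem _ _ (Submodule.mem_span_singleton_self q)

theorem exists_smul (hq : IsMinProjOf X q) {x : Matrix α α ℂ} (hx : x ∈ X) :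
    ∃ c : ℂ, q * x * q = c • q := by
  have hsx : star x ∈ X := star_mem hx
  obtain ⟨c, hc⟩ := hq.exists_smul_of_isHermitian (x := x + star x) (add_mem hx hsx)
    (IsSelfAdjoint.add_star_self x)
  obtain ⟨d, hd⟩ := hq.exists_smul_of_isHermitian (x := Complex.I • (x - star x))
    (X.smul_mem (sub_mem hx hsx) _) (by
      change star _ = _
      simp [star_smul, sub_eq_add_neg, add_comm])
  refine ⟨(2⁻¹ : ℂ) * (c - Complex.I * d), ?_⟩
  have : x = (2⁻¹ : ℂ) • ((x + star x) - Complex.I • (Complex.I • (x - star x))) := by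
    rw [smul_smul, Complex.I_mul_I]
    module
  rw [this, mul_smul_comm, smul_mul_assoc, mul_sub, sub_mul, hc, mul_smul_comm _ q,
    smul_mul_assoc, hd]
  module

end IsMinProjOf

theorem CompatibleAlg.mem_span_of_mem_sup {X Y : StarSubalgebra ℂ (Matrix α α ℂ)}
    (h : CompatibleAlg X Y) {m : Matrix α α ℂ} (hm : m ∈ X ⊔ Y) :
    m ∈ Submodule.span ℂ {m | ∃ x ∈ X, ∃ y ∈ Y, x * y = m} := by
  change m ∈ StarAlgebra.adjoin ℂ _ at hm
  induction hm using StarAlgebra.adjoin_induction with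
  | mem x hx =>
    rcases hx with hx | hx
    · exact Submodule.subset_span ⟨x, hx, 1, one_mem _, mul_one x⟩
    · exact Submodule.subset_span ⟨1, one_mem _, x, hx, one_mul x⟩
  | algebraMap r =>
    exact Submodule.subset_span ⟨_, algebraMap_mem X r, 1, one_mem _, mul_one _⟩
  | add x y _ _ hx hy => exact add_mem hx hy
  | mul x y _ _ hx hy =>
    have := Submodule.mul_mem_mul hx hy
    rw [Submodule.span_mul_span] at this
    refine Submodule.span_mono ?_ this
    rintro _ ⟨_, ⟨a, ha, b, hb, rfl⟩, _, ⟨c, hc, d, hd, rfl⟩, rfl⟩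
    refine ⟨a * c, mul_mem ha hc, b * d, mul_mem hb hd, ?_⟩
    change a * c * (b * d) = a * b * (c * d)
    rw [mul_assoc, mul_assoc, ← mul_assoc c, h c hc b hb, mul_assoc]
  | star x hm hx =>
    clear hm
    induction hx using Submodule.span_induction with
    | mem x hx =>
      obtain ⟨a, ha, b, hb, rfl⟩ := hx
      refine Submodule.subset_span ⟨_, star_mem ha, _, star_mem hb, ?_⟩
      rw [h _ (star_mem ha) _ (star_mem hb), star_mul]
    | zero => simp
    | add x y _ _ hx hy => rw [star_add]; exact add_mem hx hy
    | smul c x _ hx => rw [star_smul]; exact Submodule.smul_mem _ _ hx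

namespace IsMinProjOf

variable {X Y : StarSubalgebra ℂ (Matrix α α ℂ)} {p q : Matrix α α ℂ}

/-- Compressing the join by a minimal projection of one factor lands in the other factor. -/
theorem exists_mul_of_mem_sup (hp : IsMinProjOf X p) (h : CompatibleAlg X Y)
    {m : Matrix α α ℂ} (hm : m ∈ X ⊔ Y) : ∃ b ∈ Y, p * m * p = p * b := by
  have hspan := h.mem_span_of_mem_sup hm
  clear hm
  induction hspan using Submodule.span_induction with
  | mem m hm =>
    obtain ⟨x, hx, y, hy, rfl⟩ := hm
    obtain ⟨c, hc⟩ := hp.exists_smul hx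
    refine ⟨c • y, Y.smul_mem hy c, ?_⟩
    rw [mul_assoc, mul_assoc, ← h p hp.1 y hy, ← mul_assoc x, ← mul_assoc, ← mul_assoc, hc]
    simp
  | zero => exact ⟨0, zero_mem _, by simp⟩
  | add x y _ _ hx hy =>
    obtain ⟨a, ha, hxa⟩ := hx
    obtain ⟨b, hb, hyb⟩ := hy
    exact ⟨a + b, add_mem ha hb, by rw [mul_add, add_mul, hxa, hyb, mul_add]⟩
  | smul c x _ hx =>
    obtain ⟨a, ha, hxa⟩ := hx
    exact ⟨c • a, Y.smul_mem ha c, by rw [mul_smul_comm, smul_mul_assoc, hxa, mul_smul_comm]⟩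

theorem mul_of_compatible (hp : IsMinProjOf X p) (hq : IsMinProjOf Y q)
    (h : CompatibleAlg X Y) (h0 : p * q ≠ 0) : IsMinProjOf (X ⊔ Y) (p * q) := by
  have hpq := h p hp.1 q hq.1
  have hP := hp.2.1.mul_of_commute hq.2.1 hpq
  refine ⟨StarSubalgebra.mul_mem_sup hp.1 hq.1, hP, h0, fun e he hep hle => ?_⟩
  obtain ⟨b, hb, hpb⟩ := hp.exists_mul_of_mem_sup h he
  obtain ⟨c, hc⟩ := hq.exists_smul hb
  have hec : e = c • (p * q) := by
    calc e = (p * q) * (e * (p * q)) := by rw [hle, hP.mul_eq_of_mul_eq hep hle]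
      _ = q * (p * e * p) * q := by nth_rewrite 1 [hpq]; simp only [mul_assoc]
      _ = p * (q * b * q) := by rw [hpb, ← mul_assoc q p, ← hpq]; simp only [mul_assoc]
      _ = c • (p * q) := by rw [hc, mul_smul_comm]
  have hcc : (c * c) • (p * q) = c • (p * q) := by
    have := hep.2
    rw [hec, smul_mul_smul_comm, hP.2] at this
    exact this
  have hc2 : c * c = c := smul_left_injective ℂ h0 hcc
  rcases eq_or_ne c 0 with rfl | hc0
  · simp [hec]
  · exact Or.inr (by rw [hec, mul_eq_left₀ hc0 |>.1 hc2, one_smul])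

end IsMinProjOf

namespace IsCanonicalTrace

variable {X Y Z : StarSubalgebra ℂ (Matrix α α ℂ)} {p q s s' : Matrix α α ℂ}
  {τ τ' σ σ' : Matrix α α ℂ →ₗ[ℂ] ℂ}

theorem apply_mul_minProj_mul (hτ : IsCanonicalTrace (X ⊔ Y) τ) (hσ : IsCanonicalTrace Y σ)
    (h : CompatibleAlg X Y) (hp : IsMinProjOf X p) (hq : IsMinProjOf Y q) (h0 : p * q ≠ 0)
    (hs : s ∈ Y) : τ (s * (p * q)) = σ (s * q) := by
  obtain ⟨c, hc⟩ := hq.exists_smul hs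
  have hX : ∀ {x}, x ∈ X → x ∈ X ⊔ Y := fun hx => StarSubalgebra.mem_sup_left hx
  have hY : ∀ {y}, y ∈ Y → y ∈ X ⊔ Y := fun hy => StarSubalgebra.mem_sup_right hy
  have h1 : τ (s * (p * q)) = c := by
    calc τ (s * (p * q)) = τ (s * (p * q) * q) := by
          rw [mul_assoc, mul_assoc, hq.2.1.2]
      _ = τ (q * (s * (p * q))) :=
          hτ.1 _ (mul_mem (hY hs) (mul_mem (hX hp.1) (hY hq.1))) _ (hY hq.1)
      _ = τ (c • (p * q)) := by
          rw [← mul_smul_comm, ← hc, ← mul_assoc, ← mul_assoc, ← h p hp.1 _ (mul_mem hq.1 hs)]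
          simp only [mul_assoc]
      _ = c := by
          rw [map_smul, hτ.2.2 _ (hp.mul_of_compatible hq h h0), smul_eq_mul, mul_one]
  have h2 : σ (s * q) = c := by
    calc σ (s * q) = σ (s * q * q) := by rw [mul_assoc, hq.2.1.2]
      _ = σ (q * (s * q)) := hσ.1 _ (mul_mem hs hq.1) _ hq.1
      _ = σ (c • q) := by rw [← mul_assoc, hc]
      _ = c := by rw [map_smul, hσ.2.2 _ hq, smul_eq_mul, mul_one]
  rw [h1, h2]

theorem re_apply_mul_minProj_le (hτ : IsCanonicalTrace (X ⊔ Z) τ) (hσ : IsCanonicalTrace Z σ)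
    (h : CompatibleAlg X Z) (hp : IsMinProjOf X p) {w : Matrix α α ℂ} (hw : w.PosSemidef)
    (hwZ : w ∈ Z) : (τ (p * w)).re ≤ (σ w).re := by
  have := re_nonneg_of_posSemidef (X := Z) (σ - τ ∘ₗ LinearMap.mulLeft ℂ p) (fun e he => ?_) hw hwZ
  · simpa using this
  · by_cases h0 : p * e = 0
    · simp [h0, hσ.2.2 e he]
    · simp [hσ.2.2 e he, hτ.2.2 _ (hp.mul_of_compatible he h h0)]

theorem re_apply_mul_minProj_mul_le (hτ : IsCanonicalTrace (X ⊔ Z) τ)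
    (hτ' : IsCanonicalTrace (X ⊔ Y) τ') (hσ : IsCanonicalTrace Y σ) (hσ' : IsCanonicalTrace Z σ')
    (hYZ : Y ≤ Z) (h : CompatibleAlg X Z) (hp : IsMinProjOf X p) (hq : IsMinProjOf Y q)
    (hs : s ∈ Y) (hs' : s' ∈ Z) (hpos : s'.PosSemidef) (hss : ∀ x ∈ Y, σ' (s' * x) = σ (s * x)) :
    (τ (s' * (p * q))).re ≤ (τ' (s * (p * q))).re := by
  have hXY : CompatibleAlg X Y := fun x hx y hy => h x hx y (hYZ hy)
  by_cases h0 : p * q = 0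
  · simp [h0]
  have hqZ := hYZ hq.1
  have hX : ∀ {x}, x ∈ X → x ∈ X ⊔ Z := fun hx => StarSubalgebra.mem_sup_left hx
  have hZ : ∀ {y}, y ∈ Z → y ∈ X ⊔ Z := fun hy => StarSubalgebra.mem_sup_right hy
  rw [hτ'.apply_mul_minProj_mul hσ hXY hp hq h0 hs, ← hss q hq.1]
  have h1 : τ (s' * (p * q)) = τ (p * (q * s' * q)) := by
    calc τ (s' * (p * q)) = τ (s' * (p * q) * q) := by
          rw [mul_assoc, mul_assoc, hq.2.1.2]
      _ = τ (q * (s' * (p * q))) :=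
          hτ.1 _ (mul_mem (hZ hs') (mul_mem (hX hp.1) (hZ hqZ))) _ (hZ hqZ)
      _ = τ (p * (q * s' * q)) := by
          rw [← mul_assoc, ← mul_assoc, ← h p hp.1 _ (mul_mem hqZ hs')]
          simp only [mul_assoc]
  have h2 : σ' (s' * q) = σ' (q * s' * q) := by
    calc σ' (s' * q) = σ' (s' * q * q) := by rw [mul_assoc, hq.2.1.2]
      _ = σ' (q * s' * q) := by rw [hσ'.1 _ (mul_mem hs' hqZ) _ hqZ, mul_assoc]
  rw [h1, h2]
  refine hτ.re_apply_mul_minProj_le hσ' h hp ?_ (mul_mem (mul_mem hqZ hs') hqZ)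
  have := hpos.conjTranspose_mul_mul_same q
  rwa [hq.2.1.1.eq] at this

end IsCanonicalTrace

theorem IsProjn.mul_eq_zero_of_neg {p e b : Matrix α α ℂ} (hp : IsProjn p) (he : IsProjn e)
    (hpe : p * e = e * p) {a : ℝ} (ha : a < 0) (hbe : b * e = (a : ℂ) • e)
    (hpos : (p * b).PosSemidef) : p * e = 0 := by
  have h1 := hpos.conjTranspose_mul_mul_same e
  have h2 : eᴴ * (p * b) * e = (a : ℂ) • (p * e) := by
    rw [he.1.eq, mul_assoc, mul_assoc, hbe, mul_smul_comm, mul_smul_comm, hpe, ← mul_assoc, he.2]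
  rw [h2] at h1
  have h3 := (hp.mul_of_commute he hpe).posSemidef
  refine h3.trace_eq_zero_iff.1 ?_
  have h4 := h1.trace_nonneg
  have h5 := h3.trace_nonneg
  rw [trace_smul, smul_eq_mul, Complex.nonneg_iff] at h4
  rw [Complex.nonneg_iff] at h5
  rw [Complex.re_ofReal_mul] at h4
  refine Complex.ext ?_ h5.2.symm
  simp only [Complex.zero_re]
  nlinarith [h4.1, h5.1]

theorem CompatibleAlg.re_nonneg_of_mul_posSemidef {X Y : StarSubalgebra ℂ (Matrix α α ℂ)}
    (h : CompatibleAlg X Y) {p b : Matrix α α ℂ} (hpX : p ∈ X) (hp : IsProjn p) (hb : b ∈ Y)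
    (hpos : (p * b).PosSemidef) (f : Matrix α α ℂ →ₗ[ℂ] ℂ)
    (hf : ∀ q, IsMinProjOf Y q → 0 ≤ (f (p * q)).re) : 0 ≤ (f (p * b)).re := by
  have hsb : star b ∈ Y := star_mem hb
  have hpb : p * star b = p * b := by
    have := hpos.1.eq
    rw [conjTranspose_mul, hp.1.eq] at this
    rw [← this]
    exact h p hpX _ hsb
  have hb' : (2⁻¹ : ℂ) • (b + star b) ∈ Y := Y.smul_mem (add_mem hb hsb) _
  have hpb' : p * ((2⁻¹ : ℂ) • (b + star b)) = p * b := by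
    rw [mul_smul_comm, mul_add, hpb]; module
  have hbh : ((2⁻¹ : ℂ) • (b + star b)).IsHermitian := by
    change star _ = _
    simp [star_smul, add_comm]
  generalize (2⁻¹ : ℂ) • (b + star b) = d at hb' hpb' hbh
  rw [← hpb'] at hpos ⊢
  obtain ⟨S, F, hF⟩ := exists_spectralResolution Y hb' hbh
  rw [← hF.sum_self, Finset.mul_sum, map_sum, Complex.re_sum]
  refine Finset.sum_nonneg fun a ha => ?_
  rw [mul_smul_comm, map_smul, smul_eq_mul, Complex.re_ofReal_mul]
  rcases lt_or_ge a 0 with h0 | h0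
  · rw [hp.mul_eq_zero_of_neg (hF.isProjn a) (h p hpX _ (hF.mem a)) h0 (hF.mul_apply ha) hpos]
    simp
  · exact mul_nonneg h0 (re_nonneg_of_isMinProjOf (f ∘ₗ LinearMap.mulLeft ℂ p) hf
      (hF.isProjn a) (hF.mem a))

/-- The functional with density `s'` relative to the trace of the large algebra is dominated, on
the small algebra, by the functional with the restricted density. -/
theorem IsCanonicalTrace.re_apply_mul_le {X Y Z : StarSubalgebra ℂ (Matrix α α ℂ)}
    {s s' y : Matrix α α ℂ} {τ τ' σ σ' : Matrix α α ℂ →ₗ[ℂ] ℂ}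
    (hτ : IsCanonicalTrace (X ⊔ Z) τ)
    (hτ' : IsCanonicalTrace (X ⊔ Y) τ') (hσ : IsCanonicalTrace Y σ) (hσ' : IsCanonicalTrace Z σ')
    (hYZ : Y ≤ Z) (h : CompatibleAlg X Z)
    (hs : s ∈ Y) (hs' : s' ∈ Z) (hpos : s'.PosSemidef) (hss : ∀ x ∈ Y, σ' (s' * x) = σ (s * x))
    (hy : y ∈ X ⊔ Y) :
    (τ (s' * (y * star y))).re ≤ (τ' (s * (y * star y))).re := by
  have hXY : CompatibleAlg X Y := fun x hx y hy => h x hx y (hYZ hy)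
  have hle : X ⊔ Y ≤ X ⊔ Z := sup_le_sup_left hYZ X
  have hX : ∀ {x}, x ∈ X → x ∈ X ⊔ Y := fun hx => StarSubalgebra.mem_sup_left hx
  have hY : ∀ {y}, y ∈ Y → y ∈ X ⊔ Y := fun hy => StarSubalgebra.mem_sup_right hy
  have hZ : ∀ {y}, y ∈ Z → y ∈ X ⊔ Z := fun hy => StarSubalgebra.mem_sup_right hy
  have hmem : y * star y ∈ X ⊔ Y := mul_mem hy (star_mem hy)
  have hmpos : (y * star y).PosSemidef := posSemidef_self_mul_conjTranspose y
  generalize y * star y = m at hmem hmpos ⊢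
  let f : Matrix α α ℂ →ₗ[ℂ] ℂ := τ' ∘ₗ LinearMap.mulLeft ℂ s - τ ∘ₗ LinearMap.mulLeft ℂ s'
  have hone : IsProjn (1 : Matrix α α ℂ) := ⟨isHermitian_one, one_mul 1⟩
  suffices H : ∀ p, IsMinProjOf X p → 0 ≤ (f (p * m)).re by
    have := re_nonneg_of_isMinProjOf (f ∘ₗ LinearMap.mulRight ℂ m) H hone (one_mem X)
    simpa [f] using this
  intro p hp
  obtain ⟨b, hb, hpb⟩ := hp.exists_mul_of_mem_sup hXY hmem
  have hcyc : ∀ (W : StarSubalgebra ℂ (Matrix α α ℂ)) (φ : Matrix α α ℂ →ₗ[ℂ] ℂ)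
      (k : Matrix α α ℂ), IsCanonicalTrace W φ → X ⊔ Y ≤ W → k ∈ W → p * k = k * p →
      φ (k * (p * m)) = φ (k * (p * m * p)) := by
    intro W φ k hφ hW hk hpk
    have hpW := hW (hX hp.1)
    calc φ (k * (p * m)) = φ (p * (k * (p * m))) := by
          rw [← mul_assoc p, hpk, mul_assoc k, ← mul_assoc p, hp.2.1.2]
      _ = φ (k * (p * m) * p) := hφ.1 _ hpW _ (mul_mem hk (mul_mem hpW (hW hmem)))
      _ = _ := by rw [mul_assoc]
  have hfp : f (p * m) = f (p * b) := by
    rw [← hpb]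
    simp only [f, LinearMap.sub_apply, LinearMap.comp_apply, LinearMap.mulLeft_apply]
    rw [hcyc _ τ' s hτ' le_rfl (hY hs) (hXY p hp.1 s hs),
      hcyc _ τ s' hτ hle (hZ hs') (h p hp.1 s' hs')]
  rw [hfp]
  refine hXY.re_nonneg_of_mul_posSemidef hp.1 hp.2.1 hb ?_ f fun q hq => ?_
  · rw [← hpb]
    have := hmpos.conjTranspose_mul_mul_same p
    rwa [hp.2.1.1.eq] at this
  · have := hτ.re_apply_mul_minProj_mul_le hτ' hσ hσ' hYZ h hp hq hs hs' hpos hss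
    simpa [f] using this

namespace IsCanonicalTrace

variable {X : StarSubalgebra ℂ (Matrix α α ℂ)} {τ : Matrix α α ℂ →ₗ[ℂ] ℂ}

theorem re_apply_star (hτ : IsCanonicalTrace X τ) {m : Matrix α α ℂ} (hm : m ∈ X) :
    (τ (star m)).re = (τ m).re := by
  have h1 := (Complex.nonneg_iff.1 (hτ.2.1 1 (one_mem X))).2
  have h2 := (Complex.nonneg_iff.1 (hτ.2.1 m hm)).2
  have hI : Complex.I • m ∈ X := X.smul_mem hm _
  have h4 := (Complex.nonneg_iff.1 (hτ.2.1 _ (add_mem (one_mem X) hI))).2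
  simp only [star_add, star_one, star_smul, add_mul, mul_add, one_mul, mul_one, map_add,
    smul_mul_smul_comm, map_smul, Complex.add_im, smul_eq_mul] at h1 h2 h4
  simp at h1 h2 h4
  linarith

theorem nonneg_of_spectralResolution (hτ : IsCanonicalTrace X τ) {r Z : Matrix α α ℂ}
    {S : Finset ℝ} {E : ℝ → Matrix α α ℂ} (hE : SpectralResolution X r S E) (hr : r.PosSemidef)
    (hZ : Z ∈ X) : 0 ≤ (τ (star Z * (r * Z))).re := by
  rw [← hE.sum_self, Finset.sum_mul, Finset.mul_sum, map_sum, Complex.re_sum]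
  refine Finset.sum_nonneg fun a ha => ?_
  rw [smul_mul_assoc, mul_smul_comm, map_smul, smul_eq_mul, Complex.re_ofReal_mul]
  refine mul_nonneg (hE.nonneg hr a ha) ?_
  have h1 := (Complex.nonneg_iff.1 (hτ.2.1 _ (mul_mem (hE.mem a) hZ))).1
  rwa [star_mul, show star (E a) = E a from hE.isHermitian a, mul_assoc, ← mul_assoc (E a),
    hE.mul_self] at h1

theorem re_apply_mul_nonneg (hτ : IsCanonicalTrace X τ) {p q : Matrix α α ℂ} (hp : IsProjn p)
    (hq : IsProjn q) (hpX : p ∈ X) (hqX : q ∈ X) : 0 ≤ (τ (p * q)).re := by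
  have h1 := (Complex.nonneg_iff.1 (hτ.2.1 _ (mul_mem hpX hqX))).1
  rw [star_mul, show star p = p from hp.1, show star q = q from hq.1, mul_assoc,
    hτ.1 _ hqX _ (mul_mem hpX (mul_mem hpX hqX)), mul_assoc, mul_assoc, hq.2, ← mul_assoc,
    hp.2] at h1
  exact h1

end IsCanonicalTrace

/-- The quadratic form whose supremum over the algebra is a resolvent of the relative modular
operator. -/
noncomputable def relModularForm (τ : Matrix α α ℂ →ₗ[ℂ] ℂ) (r s : Matrix α α ℂ) (t : ℝ)
    (Z : Matrix α α ℂ) : ℝ :=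
  2 * (τ (r * Z)).re - (τ (s * (Z * star Z))).re - t * (τ (r * (star Z * Z))).re

/-- The supremum of `relModularForm`, expressed through spectral resolutions. -/
noncomputable def relModularSum (τ : Matrix α α ℂ →ₗ[ℂ] ℂ) (S T : Finset ℝ)
    (E F : ℝ → Matrix α α ℂ) (t : ℝ) : ℝ :=
  ∑ i ∈ S ×ˢ T, (τ (E i.1 * F i.2)).re * i.1 ^ 2 / (i.2 + t * i.1)

section RelModular

variable {X : StarSubalgebra ℂ (Matrix α α ℂ)} {τ : Matrix α α ℂ →ₗ[ℂ] ℂ} {r s : Matrix α α ℂ}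
  {S T : Finset ℝ} {E F : ℝ → Matrix α α ℂ}

theorem exists_relModularForm_eq (hτ : IsCanonicalTrace X τ) (hr : r.PosSemidef)
    (hs : s.PosSemidef) (hE : SpectralResolution X r S E) (hF : SpectralResolution X s T F)
    {t : ℝ} (ht : 0 < t) :
    (∃ Z ∈ X, relModularForm τ r s t Z = relModularSum τ S T E F t) ∧
      ∀ Z ∈ X, relModularForm τ r s t Z ≤ relModularSum τ S T E F t := by
  have hrX : r ∈ X := hE.sum_self ▸ sum_mem fun a _ => X.smul_mem (hE.mem a) _
  have hsX : s ∈ X := hF.sum_self ▸ sum_mem fun a _ => X.smul_mem (hF.mem a) _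
  have hrs : star r = r := hr.1
  have hss : star s = s := hs.1
  let c : ℝ × ℝ → ℝ := fun i => i.1 / (i.2 + t * i.1)
  let Z₀ : Matrix α α ℂ := ∑ i ∈ S ×ˢ T, (c i : ℂ) • (F i.2 * E i.1)
  have hZ₀ : Z₀ ∈ X := sum_mem fun i _ => X.smul_mem (mul_mem (hF.mem _) (hE.mem _)) _
  have hK : s * Z₀ + (t : ℂ) • (Z₀ * r) = r := by
    have h1 : s * Z₀ + (t : ℂ) • (Z₀ * r) = ∑ i ∈ S ×ˢ T, (i.1 : ℂ) • (F i.2 * E i.1) := by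
      simp only [Z₀]
      rw [Finset.mul_sum, Finset.sum_mul, Finset.smul_sum, ← Finset.sum_add_distrib]
      refine Finset.sum_congr rfl fun i hi => ?_
      obtain ⟨h1, h2⟩ := Finset.mem_product.1 hi
      rw [mul_smul_comm, ← mul_assoc, hF.mul_apply h2, smul_mul_assoc, smul_mul_assoc,
        mul_assoc, hE.apply_mul h1, mul_smul_comm, smul_smul, smul_smul, smul_smul,
        ← add_smul]
      congr 1
      have hi1 := hE.nonneg hr _ h1
      have hi2 := hF.nonneg hs _ h2
      have : c i * i.2 + t * c i * i.1 = i.1 := by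
        rcases hi1.eq_or_lt with h0 | h0
        · simp [c, ← h0]
        · simp only [c]
          field_simp
      exact_mod_cast this
    rw [h1, Finset.sum_product]
    calc _ = ∑ a ∈ S, (a : ℂ) • ((∑ b ∈ T, F b) * E a) := by
          simp only [Finset.sum_mul, Finset.smul_sum]
      _ = r := by simp only [hF.sum_one, one_mul, hE.sum_self]
  have hval : (τ (r * Z₀)).re = relModularSum τ S T E F t := by
    simp only [Z₀, relModularSum]
    rw [Finset.mul_sum, map_sum, Complex.re_sum]
    refine Finset.sum_congr rfl fun i hi => ?_
    obtain ⟨h1, h2⟩ := Finset.mem_product.1 hi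
    rw [mul_smul_comm, map_smul, smul_eq_mul, Complex.re_ofReal_mul,
      hτ.1 _ hrX _ (mul_mem (hF.mem _) (hE.mem _)), mul_assoc, hE.apply_mul h1, mul_smul_comm,
      map_smul, smul_eq_mul, Complex.re_ofReal_mul, hτ.1 _ (hF.mem _) _ (hE.mem _)]
    simp only [c]
    ring
  let B : Matrix α α ℂ → Matrix α α ℂ → ℝ := fun Y Z =>
    (τ (star Y * (s * Z + (t : ℂ) • (Z * r)))).re
  have hBexp : ∀ Y Z, B Y Z = (τ (star Y * (s * Z))).re + t * (τ (star Y * (Z * r))).re := by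
    intro Y Z
    simp only [B]
    rw [mul_add, mul_smul_comm, map_add, map_smul, Complex.add_re, smul_eq_mul,
      Complex.re_ofReal_mul]
  have hBsymm : ∀ Y ∈ X, ∀ Z ∈ X, B Y Z = B Z Y := by
    intro Y hY Z hZ
    rw [hBexp, hBexp]
    congr 1
    · rw [← hτ.re_apply_star (mul_mem (star_mem hY) (mul_mem hsX hZ))]
      simp only [star_mul, star_star, hss, mul_assoc]
    · rw [← hτ.re_apply_star (mul_mem (star_mem hY) (mul_mem hZ hrX))]
      simp only [star_mul, star_star, hrs]
      rw [mul_assoc, hτ.1 _ hrX _ (mul_mem (star_mem hZ) hY), mul_assoc]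
  have hBnonneg : ∀ Z ∈ X, 0 ≤ B Z Z := by
    intro Z hZ
    rw [hBexp]
    refine add_nonneg (hτ.nonneg_of_spectralResolution hF hs hZ) (mul_nonneg ht.le ?_)
    have := hτ.nonneg_of_spectralResolution hE hr (star_mem hZ)
    rwa [star_star, hτ.1 _ hZ _ (mul_mem hrX (star_mem hZ)), mul_assoc,
      hτ.1 _ hrX _ (mul_mem (star_mem hZ) hZ), mul_assoc] at this
  have hBZ₀ : ∀ Z ∈ X, B Z Z₀ = (τ (r * Z)).re := by
    intro Z hZ
    simp only [B]
    rw [hK, ← hτ.re_apply_star (mul_mem (star_mem hZ) hrX), star_mul, star_star, hrs]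
  have hform : ∀ Z ∈ X, relModularForm τ r s t Z =
      relModularSum τ S T E F t - B (Z - Z₀) (Z - Z₀) := by
    intro Z hZ
    have h1 : B (Z - Z₀) (Z - Z₀) = B Z Z - B Z Z₀ - (B Z₀ Z - B Z₀ Z₀) := by
      simp only [hBexp, star_sub, sub_mul, mul_sub, map_sub, Complex.sub_re]
      ring
    have h2 : B Z Z = (τ (s * (Z * star Z))).re + t * (τ (r * (star Z * Z))).re := by
      rw [hBexp, hτ.1 _ (star_mem hZ) _ (mul_mem hsX hZ), mul_assoc, ← mul_assoc (star Z),
        hτ.1 _ (mul_mem (star_mem hZ) hZ) _ hrX]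
    rw [h1, hBsymm _ hZ₀ _ hZ, hBZ₀ Z hZ, hBZ₀ _ hZ₀, hval, h2, relModularForm]
    ring
  refine ⟨⟨Z₀, hZ₀, ?_⟩, fun Z hZ => ?_⟩
  · rw [hform _ hZ₀]
    simp [B]
  · rw [hform Z hZ]
    exact sub_le_self _ (hBnonneg _ (sub_mem hZ hZ₀))

theorem sum_product_mul_self (hF : SpectralResolution X s T F) (f : ℝ → ℝ) :
    ∑ i ∈ S ×ˢ T, (τ (E i.1 * F i.2)).re * f i.1 = (τ (∑ a ∈ S, (f a : ℂ) • E a)).re := by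
  rw [Finset.sum_product, map_sum, Complex.re_sum]
  refine Finset.sum_congr rfl fun a _ => ?_
  dsimp only
  rw [← Finset.sum_mul, ← Complex.re_sum, ← map_sum, ← Finset.mul_sum, hF.sum_one, mul_one,
    map_smul, smul_eq_mul, Complex.re_ofReal_mul, mul_comm]

theorem sum_product_mul_mul (hE : SpectralResolution X r S E) (f : ℝ → ℝ) :
    ∑ i ∈ S ×ˢ T, (τ (E i.1 * F i.2)).re * i.1 * f i.2
      = (τ (r * ∑ b ∈ T, (f b : ℂ) • F b)).re := by
  rw [Finset.sum_product_right, Finset.mul_sum, map_sum, Complex.re_sum]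
  refine Finset.sum_congr rfl fun b _ => ?_
  rw [mul_smul_comm, map_smul, smul_eq_mul, Complex.re_ofReal_mul]
  conv_rhs => rw [← hE.sum_self]
  rw [Finset.sum_mul, map_sum, Complex.re_sum, Finset.mul_sum]
  refine Finset.sum_congr rfl fun a _ => ?_
  rw [smul_mul_assoc, map_smul, smul_eq_mul, Complex.re_ofReal_mul]
  ring

end RelModular

section LogSums

open Filter Topology

variable {ι κ : Type*}

theorem hasDerivAt_sum_mul_log (S : Finset ι) {w p q : ι → ℝ} (hp : ∀ i ∈ S, 0 ≤ p i)
    (hq : ∀ i ∈ S, 0 ≤ q i) {t : ℝ} (ht : 0 < t) :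
    HasDerivAt (fun t => ∑ i ∈ S, w i * p i * Real.log (q i + t * p i))
      (∑ i ∈ S, w i * p i ^ 2 / (q i + t * p i)) t := by
  refine HasDerivAt.fun_sum fun i hi => ?_
  rcases (hp i hi).eq_or_lt with h | h
  · simp [← h, hasDerivAt_const]
  · have h1 : HasDerivAt (fun t => q i + t * p i) (p i) t := by
      simpa using ((hasDerivAt_id t).mul_const (p i)).const_add (q i)
    have h2 := (h1.log (by have := hq i hi; positivity)).const_mul (w i * p i)
    rwa [show w i * p i ^ 2 / (q i + t * p i) = w i * p i * (p i / (q i + t * p i)) by ring]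

theorem continuousOn_sum_mul_log (S : Finset ι) {w p q : ι → ℝ} (hp : ∀ i ∈ S, 0 ≤ p i)
    (hq : ∀ i ∈ S, 0 ≤ q i) (hsupp : ∀ i ∈ S, q i = 0 → w i * p i = 0) :
    ContinuousOn (fun t => ∑ i ∈ S, w i * p i * Real.log (q i + t * p i)) (Set.Ici 0) := by
  refine continuousOn_finsetSum _ fun i hi => ?_
  rcases (hq i hi).eq_or_lt with h | h
  · simp [hsupp i hi h.symm, continuousOn_const]
  · refine continuousOn_const.mul (ContinuousOn.log (by fun_prop) fun t ht => ?_)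
    have := mul_nonneg (Set.mem_Ici.1 ht) (hp i hi)
    positivity

theorem tendsto_sum_mul_log_sub (S : Finset ι) {w p q : ι → ℝ} (hp : ∀ i ∈ S, 0 ≤ p i)
    (hq : ∀ i ∈ S, 0 ≤ q i) :
    Tendsto (fun t => ∑ i ∈ S, w i * p i * Real.log (q i + t * p i)
        - (∑ i ∈ S, w i * p i) * Real.log t) atTop
      (𝓝 (∑ i ∈ S, w i * p i * Real.log (p i))) := by
  have h1 : Tendsto (fun t => ∑ i ∈ S, w i * p i * Real.log (q i * t⁻¹ + p i)) atTop
      (𝓝 (∑ i ∈ S, w i * p i * Real.log (p i))) := by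
    refine tendsto_finsetSum _ fun i hi => ?_
    rcases (hp i hi).eq_or_lt with h | h
    · simp [← h]
    · refine Tendsto.const_mul _ (Tendsto.log ?_ h.ne')
      simpa using (tendsto_inv_atTop_zero.const_mul (q i)).add_const (p i)
  refine h1.congr' ?_
  filter_upwards [eventually_gt_atTop 0] with t ht
  rw [Finset.sum_mul, ← Finset.sum_sub_distrib]
  refine Finset.sum_congr rfl fun i hi => ?_
  rcases (hp i hi).eq_or_lt with h | h
  · simp [← h]
  · have := hq i hi
    rw [← mul_sub, ← Real.log_div (by positivity) ht.ne']
    congr 2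
    field_simp

theorem sum_mul_log_sub_le (S : Finset ι) (T : Finset κ) {w p q : ι → ℝ} {w' p' q' : κ → ℝ}
    (hp : ∀ i ∈ S, 0 ≤ p i) (hq : ∀ i ∈ S, 0 ≤ q i) (hsupp : ∀ i ∈ S, q i = 0 → w i * p i = 0)
    (hp' : ∀ i ∈ T, 0 ≤ p' i) (hq' : ∀ i ∈ T, 0 ≤ q' i)
    (hsupp' : ∀ i ∈ T, q' i = 0 → w' i * p' i = 0)
    (hsum : ∑ i ∈ S, w i * p i = ∑ i ∈ T, w' i * p' i)
    (h : ∀ t > 0, ∑ i ∈ T, w' i * p' i ^ 2 / (q' i + t * p' i)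
      ≤ ∑ i ∈ S, w i * p i ^ 2 / (q i + t * p i)) :
    ∑ i ∈ S, w i * p i * Real.log (q i) - ∑ i ∈ T, w' i * p' i * Real.log (q' i)
      ≤ ∑ i ∈ S, w i * p i * Real.log (p i) - ∑ i ∈ T, w' i * p' i * Real.log (p' i) := by
  have hd := fun t (ht : 0 < t) => (hasDerivAt_sum_mul_log S (w := w) hp hq ht).sub
    (hasDerivAt_sum_mul_log T (w := w') hp' hq' ht)
  have hmono := monotoneOn_of_deriv_nonneg (convex_Ici (0 : ℝ))
    ((continuousOn_sum_mul_log S hp hq hsupp).sub (continuousOn_sum_mul_log T hp' hq' hsupp'))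
    (fun t ht => (hd t (by simpa using ht)).differentiableAt.differentiableWithinAt)
    (fun t ht => by
      have ht' : 0 < t := by simpa using ht
      rw [(hd t ht').deriv]
      exact sub_nonneg.2 (h t ht'))
  refine ge_of_tendsto ((tendsto_sum_mul_log_sub S hp hq).sub
    (tendsto_sum_mul_log_sub T hp' hq')) ?_
  filter_upwards [eventually_ge_atTop 0] with t ht
  have := hmono (Set.mem_Ici.2 le_rfl) (Set.mem_Ici.2 ht) ht
  simp only [Pi.sub_apply, zero_mul, add_zero] at this
  rw [hsum]
  linarith

end LogSums

theorem CompatibleAlg.sup_right {X Y Z : StarSubalgebra ℂ (Matrix α α ℂ)}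
    (hXY : CompatibleAlg X Y) (hXZ : CompatibleAlg X Z) (hYZ : CompatibleAlg Y Z) :
    CompatibleAlg X (Y ⊔ Z) := by
  intro x hx m hm
  have hspan := hYZ.mem_span_of_mem_sup hm
  clear hm
  induction hspan using Submodule.span_induction with
  | mem m hm =>
    obtain ⟨y, hy, z, hz, rfl⟩ := hm
    rw [← mul_assoc, hXY x hx y hy, mul_assoc, hXZ x hx z hz, mul_assoc]
  | zero => simp
  | add x y _ _ hx hy => rw [mul_add, add_mul, hx, hy]
  | smul c x _ hx => rw [mul_smul_comm, smul_mul_assoc, hx]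

theorem CompatibleAlg.bot_left (Y : StarSubalgebra ℂ (Matrix α α ℂ)) : CompatibleAlg ⊥ Y := by
  intro x hx y _
  obtain ⟨c, rfl⟩ := StarSubalgebra.mem_bot.1 hx
  exact Algebra.commutes c y

theorem CompatibleAlg.bot_right (X : StarSubalgebra ℂ (Matrix α α ℂ)) : CompatibleAlg X ⊥ :=
  fun x hx y hy => (CompatibleAlg.bot_left X y hy x hx).symm

/-- If `r` gives no weight to the kernel of `s`, the joint spectral weights vanish there. -/
theorem weight_eq_zero {X : StarSubalgebra ℂ (Matrix α α ℂ)} {τ : Matrix α α ℂ →ₗ[ℂ] ℂ}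
    {r s : Matrix α α ℂ} {S T : Finset ℝ} {E F : ℝ → Matrix α α ℂ}
    (hτ : IsCanonicalTrace X τ) (hr : r.PosSemidef)
    (hE : SpectralResolution X r S E) (hF : SpectralResolution X s T F)
    (hsupp : 0 ∈ T → (τ (r * F 0)).re = 0) :
    ∀ i ∈ S ×ˢ T, i.2 = 0 → (τ (E i.1 * F i.2)).re * i.1 = 0 := by
  rintro ⟨a, b⟩ hi rfl
  obtain ⟨ha, h0⟩ := Finset.mem_product.1 hi
  have h1 := hsupp h0
  rw [← hE.sum_self, Finset.sum_mul, map_sum, Complex.re_sum, Finset.sum_eq_zero_iff_of_nonneg] at h1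
  · have h2 := h1 a ha
    rw [smul_mul_assoc, map_smul, smul_eq_mul, Complex.re_ofReal_mul] at h2
    rw [mul_comm]
    exact h2
  · intro a ha
    rw [smul_mul_assoc, map_smul, smul_eq_mul, Complex.re_ofReal_mul]
    exact mul_nonneg (hE.nonneg hr a ha)
      (hτ.re_apply_mul_nonneg (hE.isProjn a) (hF.isProjn 0) (hE.mem a) (hF.mem 0))

/-- Monotonicity of the relative entropy under restriction to a subalgebra. -/
theorem relEntropy_mono {X X' Y Y' : StarSubalgebra ℂ (Matrix α α ℂ)}
    {τ τ' : Matrix α α ℂ →ₗ[ℂ] ℂ} {r s r' s' : Matrix α α ℂ}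
    (hτ : IsCanonicalTrace X τ) (hτ' : IsCanonicalTrace X' τ') (hle : X' ≤ X)
    (hYX : Y ≤ X) (hYX' : Y' ≤ X')
    (hrX : r ∈ X) (hr : r.PosSemidef) (hsY : s ∈ Y) (hs : s.PosSemidef)
    (hrX' : r' ∈ X') (hr' : r'.PosSemidef) (hsY' : s' ∈ Y') (hs' : s'.PosSemidef)
    (hrr : ∀ x ∈ X', τ (r * x) = τ' (r' * x))
    (hss : ∀ x ∈ X', (τ (s * (x * star x))).re ≤ (τ' (s' * (x * star x))).re)
    (hsupp : ∀ x ∈ Y, s * x = 0 → (τ (r * x)).re = 0)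
    (hsupp' : ∀ x ∈ Y', s' * x = 0 → (τ' (r' * x)).re = 0) :
    (τ (r * matLogb s)).re - (τ' (r' * matLogb s')).re
      ≤ (τ (r * matLogb r)).re - (τ' (r' * matLogb r')).re := by
  obtain ⟨S, E, hE⟩ := exists_spectralResolution X hrX hr.1
  obtain ⟨T, F, hFY⟩ := exists_spectralResolution Y hsY hs.1
  obtain ⟨S', E', hE'⟩ := exists_spectralResolution X' hrX' hr'.1
  obtain ⟨T', F', hFY'⟩ := exists_spectralResolution Y' hsY' hs'.1
  have hF := hFY.mono hYX
  have hF' := hFY'.mono hYX'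
  have hw := weight_eq_zero hτ hr hE hF fun h0 =>
    hsupp _ (hFY.mem 0) (by rw [hF.mul_apply h0]; simp)
  have hw' := weight_eq_zero hτ' hr' hE' hF' fun h0 =>
    hsupp' _ (hFY'.mem 0) (by rw [hF'.mul_apply h0]; simp)
  have hsum : ∑ i ∈ S ×ˢ T, (τ (E i.1 * F i.2)).re * i.1
      = ∑ i ∈ S' ×ˢ T', (τ' (E' i.1 * F' i.2)).re * i.1 := by
    have h1 := hrr 1 (one_mem X')
    rw [mul_one, mul_one] at h1
    rw [sum_product_mul_self hF (fun a => a), sum_product_mul_self hF' (fun a => a),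
      hE.sum_self, hE'.sum_self, h1]
  have key := sum_mul_log_sub_le (S ×ˢ T) (S' ×ˢ T')
    (w := fun i => (τ (E i.1 * F i.2)).re) (p := Prod.fst) (q := Prod.snd)
    (w' := fun i => (τ' (E' i.1 * F' i.2)).re) (p' := Prod.fst) (q' := Prod.snd)
    (fun i hi => hE.nonneg hr _ (Finset.mem_product.1 hi).1)
    (fun i hi => hF.nonneg hs _ (Finset.mem_product.1 hi).2) hw
    (fun i hi => hE'.nonneg hr' _ (Finset.mem_product.1 hi).1)
    (fun i hi => hF'.nonneg hs' _ (Finset.mem_product.1 hi).2) hw' hsum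
    (fun t ht => by
      obtain ⟨⟨Z, hZ, hZeq⟩, -⟩ := exists_relModularForm_eq hτ' hr' hs' hE' hF' ht
      have h2 := (exists_relModularForm_eq hτ hr hs hE hF ht).2 Z (hle hZ)
      change relModularSum τ' S' T' E' F' t ≤ relModularSum τ S T E F t
      refine hZeq.symm.le.trans (le_trans ?_ h2)
      rw [relModularForm, relModularForm, hrr Z hZ, hrr _ (mul_mem (star_mem hZ) hZ)]
      linarith [hss Z hZ])
  have hlog : 0 < Real.log 2 := Real.log_pos one_lt_two
  have hself : ∀ (τ : Matrix α α ℂ →ₗ[ℂ] ℂ) (X : StarSubalgebra ℂ (Matrix α α ℂ))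
      (r s : Matrix α α ℂ) (S T : Finset ℝ)
      (E F : ℝ → Matrix α α ℂ), SpectralResolution X r S E → SpectralResolution X s T F →
      (τ (r * matLogb r)).re
        = (∑ i ∈ S ×ˢ T, (τ (E i.1 * F i.2)).re * i.1 * Real.log i.1) / Real.log 2 ∧
      (τ (r * matLogb s)).re
        = (∑ i ∈ S ×ˢ T, (τ (E i.1 * F i.2)).re * i.1 * Real.log i.2) / Real.log 2 := by
    intro τ X r s S T E F hE hF
    constructor
    · rw [hE.mul_matLogb, ← sum_product_mul_self hF, Finset.sum_div]
      refine Finset.sum_congr rfl fun i _ => ?_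
      rw [Real.logb]; ring
    · rw [← hF.sum_log, ← sum_product_mul_mul hE, Finset.sum_div]
      refine Finset.sum_congr rfl fun i _ => ?_
      rw [Real.logb]; ring
  obtain ⟨h1, h2⟩ := hself τ X r s S T E F hE hF
  obtain ⟨h3, h4⟩ := hself τ' X' r' s' S' T' E' F' hE' hF'
  rw [h1, h2, h3, h4, ← sub_div, ← sub_div]
  exact div_le_div_of_nonneg_right key hlog.le

theorem strong_subadditivity {ρ : Matrix α α ℂ} {X Y Z : StarSubalgebra ℂ (Matrix α α ℂ)}
    (hXY : CompatibleAlg X Y) (hXZ : CompatibleAlg X Z) (hYZ : CompatibleAlg Y Z)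
    {H2 H12 H23 H123 : ℝ}
    (hH2 : IsAlgEntropy Y ρ H2) (hH12 : IsAlgEntropy (X ⊔ Y) ρ H12)
    (hH23 : IsAlgEntropy (Y ⊔ Z) ρ H23) (hH123 : IsAlgEntropy (X ⊔ Y ⊔ Z) ρ H123) :
    H123 + H2 ≤ H12 + H23 := by
  rw [sup_assoc] at hH123
  obtain ⟨τ, r, hτ, ⟨hrX, hr, hrρ⟩, rfl⟩ := hH123
  obtain ⟨τ', r', hτ', ⟨hrX', hr', hrρ'⟩, rfl⟩ := hH12
  obtain ⟨σ, s, hσ, ⟨hsX, hs, hsρ⟩, rfl⟩ := hH23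
  obtain ⟨σ', s', hσ', ⟨hsX', hs', hsρ'⟩, rfl⟩ := hH2
  have hle : X ⊔ Y ≤ X ⊔ (Y ⊔ Z) := sup_le_sup_left le_sup_left X
  have hZ : Y ⊔ Z ≤ X ⊔ (Y ⊔ Z) := le_sup_right
  have hY : Y ≤ X ⊔ Y := le_sup_right
  have key := relEntropy_mono hτ hτ' hle hZ hY hrX hr hsX hs hrX' hr' hsX' hs'
    (fun x hx => by rw [hrρ x (hle hx), hrρ' x hx])
    (fun x hx => hτ.re_apply_mul_le hτ' hσ' hσ le_sup_left (hXY.sup_right hXZ hYZ) hsX' hsX hs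
      (fun y hy => by rw [hsρ y (StarSubalgebra.mem_sup_left hy), hsρ' y hy]) hx)
    (fun x hx h0 => by rw [hrρ x (hZ hx), ← hsρ x hx, h0]; simp)
    (fun x hx h0 => by rw [hrρ' x (hY hx), ← hsρ' x hx, h0]; simp)
  obtain ⟨T, F, hF⟩ := exists_spectralResolution _ hsX hs.1
  obtain ⟨T', F', hF'⟩ := exists_spectralResolution _ hsX' hs'.1
  rw [hrρ _ (hZ hF.matLogb_mem), ← hsρ _ hF.matLogb_mem, hrρ' _ (hY hF'.matLogb_mem),
    ← hsρ' _ hF'.matLogb_mem] at key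
  simp only [algEntropy]
  linarith

theorem matLogb_one : matLogb (1 : Matrix α α ℂ) = 0 := by
  rw [matLogb_eq_cfc isHermitian_one, cfc_apply_one]
  simp

/-- The trivial subalgebra has zero entropy in every state. -/
theorem isAlgEntropy_bot [Nonempty α] {ρ : Matrix α α ℂ} (hρ : MatState ρ) :
    IsAlgEntropy ⊥ ρ 0 := by
  obtain ⟨i⟩ := ‹Nonempty α›
  let τ : Matrix α α ℂ →ₗ[ℂ] ℂ := Matrix.entryLinearMap ℂ ℂ i i
  have hτ : ∀ c : ℂ, τ (algebraMap ℂ _ c) = c := fun c => by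
    simp [τ, Matrix.algebraMap_matrix_apply]
  refine ⟨τ, 1, ⟨?_, ?_, ?_⟩, ⟨one_mem _, PosSemidef.one, ?_⟩, ?_⟩
  · intro x hx y _
    obtain ⟨c, rfl⟩ := StarSubalgebra.mem_bot.1 hx
    rw [Algebra.commutes]
  · intro x hx
    obtain ⟨c, rfl⟩ := StarSubalgebra.mem_bot.1 hx
    rw [← algebraMap_star_comm, ← map_mul, hτ]
    exact star_mul_self_nonneg c
  · rintro p ⟨hp, hpp, h0, -⟩
    obtain ⟨c, rfl⟩ := StarSubalgebra.mem_bot.1 hp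
    rw [hτ]
    have hc : c * c = c := by
      have := congrArg τ hpp.2
      rwa [← map_mul, hτ, hτ] at this
    have hc0 : c ≠ 0 := by
      rintro rfl
      exact h0 (map_zero _)
    exact (mul_eq_left₀ hc0).1 hc
  · intro x hx
    obtain ⟨c, rfl⟩ := StarSubalgebra.mem_bot.1 hx
    rw [one_mul, hτ, Algebra.algebraMap_eq_smul_one, mul_smul_comm, mul_one, trace_smul, hρ.2,
      smul_eq_mul, mul_one]
  · simp [algEntropy, matLogb_one]

/-- subadditivity and strong subadditivity of the entropy for
pairwise compatible unital *-subalgebras `𝔄₁, 𝔄₂, 𝔄₃` of `M_n(ℂ)`. -/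
theorem subadditivity_and_strong_subadditivity {n : ℕ}
    (ρ : Matrix (Fin n) (Fin n) ℂ) (hρ : MatState ρ)
    (𝔄₁ 𝔄₂ 𝔄₃ : StarSubalgebra ℂ (Matrix (Fin n) (Fin n) ℂ))
    (h12 : CompatibleAlg 𝔄₁ 𝔄₂) (h13 : CompatibleAlg 𝔄₁ 𝔄₃)
    (h23 : CompatibleAlg 𝔄₂ 𝔄₃)
    (H1 H2 H12 H23 H123 : ℝ)
    (hH1 : IsAlgEntropy 𝔄₁ ρ H1) (hH2 : IsAlgEntropy 𝔄₂ ρ H2)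
    (hH12 : IsAlgEntropy (𝔄₁ ⊔ 𝔄₂) ρ H12)
    (hH23 : IsAlgEntropy (𝔄₂ ⊔ 𝔄₃) ρ H23)
    (hH123 : IsAlgEntropy (𝔄₁ ⊔ 𝔄₂ ⊔ 𝔄₃) ρ H123) :
    H12 ≤ H1 + H2 ∧ H123 + H2 ≤ H12 + H23 := by
  refine ⟨?_, strong_subadditivity h12 h13 h23 hH2 hH12 hH23 hH123⟩
  have : Nonempty (Fin n) := by
    rw [← not_isEmpty_iff]
    intro h
    have := hρ.2
    simp [Matrix.trace] at this
  have := strong_subadditivity (.bot_right 𝔄₁) h12 (.bot_left 𝔄₂) (isAlgEntropy_bot hρ)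
    (by rwa [sup_bot_eq]) (by rwa [bot_sup_eq]) (by rwa [sup_bot_eq])
  linarith
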